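/- If X is a sober Q-topological space, then its specialization Q-order ΩX is F-cocomplete: every flat ideal φ of ΩX has a supremum. In fact, the point p(λ) = ⋁_x φ(x)&λ(x) of the Q-module O(X) corresponds to an element a with λ(a) = p(λ) for all open λ, and a = sup φ. -/

import Mathlib

/-- The specialization `Q`-order of a sober `Q`-topological space is
`F`-cocomplete: every flat ideal `φ` has a supremum `a`, which is the unique
point corresponding to the point `p(λ) = φ ⋔ λ` of the module `O(X)`. -/
theorem sober_specialization_F_cocomplete
    (Q : Type*) [CompleteLattice Q]
    (op : Q → Q → Q) (imp : Q → Q → Q) (k : Q)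
    (comm : ∀ a b, op a b = op b a)
    (assoc : ∀ a b c, op (op a b) c = op a (op b c))
    (unit : ∀ a, op k a = a)
    (adj : ∀ p q r, op p q ≤ r ↔ q ≤ imp p r)
    -- a Q-topological space (X, τ)
    (X : Type*) (τ : Set (X → Q))
    (htop : (fun _ : X => (⊤ : Q)) ∈ τ)
    (hinf : ∀ lam mu, lam ∈ τ → mu ∈ τ → lam ⊓ mu ∈ τ)
    (hSup : ∀ S : Set (X → Q), S ⊆ τ → sSup S ∈ τ)
    (hscalar : ∀ lam, lam ∈ τ → ∀ r : Q, (fun x => op (lam x) r) ∈ τ)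
    -- X is sober
    (sober : ∀ p : (X → Q) → Q,
      (p (fun _ => ⊤) = ⊤) →
      (∀ lam mu, lam ∈ τ → mu ∈ τ → p (lam ⊓ mu) = p lam ⊓ p mu) →
      (∀ S : Set (X → Q), S ⊆ τ → p (sSup S) = ⨆ lam ∈ S, p lam) →
      (∀ lam, lam ∈ τ → ∀ r : Q, p (fun x => op (lam x) r) = op (p lam) r) →
      ∃! x : X, ∀ lam ∈ τ, p lam = lam x)
    -- the specialization Q-order
    (Ω : X → X → Q) (hΩ : ∀ x y, Ω x y = ⨅ lam ∈ τ, imp (lam x) (lam y))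
    -- a flat ideal of (X, Ω)
    (φ : X → Q)
    (weight : ∀ x y, op (φ y) (Ω x y) ≤ φ x)
    (inhabited : k ≤ ⨆ x, φ x)
    (flat : ∀ ψ₁ ψ₂ : X → Q,
      (∀ x y, op (Ω x y) (ψ₁ x) ≤ ψ₁ y) → (∀ x y, op (Ω x y) (ψ₂ x) ≤ ψ₂ y) →
      (⨆ x, op (φ x) (ψ₁ x ⊓ ψ₂ x)) =
        (⨆ x, op (φ x) (ψ₁ x)) ⊓ (⨆ x, op (φ x) (ψ₂ x))) :
    ∃ a : X,
      (∀ lam ∈ τ, (⨆ x, op (φ x) (lam x)) = lam a) ∧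
      (∀ y : X, Ω a y = ⨅ x, imp (φ x) (Ω x y)) := by
  have opS : ∀ {ι : Type _} (a : Q) (f : ι → Q), op a (⨆ i, f i) = ⨆ i, op a (f i) := by
    intro ι a f
    apply eq_of_forall_ge_iff
    intro c
    rw [adj, iSup_le_iff, iSup_le_iff]
    simp only [adj]
  have mono : ∀ a b c : Q, a ≤ b → op a c ≤ op b c := by
    intro a b c h
    rw [comm a c, adj]
    exact h.trans ((adj c b (op b c)).1 (comm c b).le)
  have opS' : ∀ (f : X → Q) (a : Q), op (⨆ i, f i) a = ⨆ i, op (f i) a := by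
    intro f a
    rw [comm, opS]
    exact iSup_congr fun i => comm _ _
  have cow : ∀ lam ∈ τ, ∀ x y, op (Ω x y) (lam x) ≤ lam y := by
    intro lam hl x y
    rw [comm, adj, hΩ]
    exact iInf₂_le lam hl
  obtain ⟨a, ha, -⟩ := sober (fun lam => ⨆ x, op (φ x) (lam x))
    (by
      show (⨆ x, op (φ x) ⊤) = ⊤
      rw [← opS']
      apply top_unique
      calc (⊤ : Q) = op k ⊤ := (unit _).symm
        _ ≤ _ := mono _ _ _ inhabited)
    (fun lam mu hl hm => flat lam mu (cow lam hl) (cow mu hm))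
    (by
      intro S _
      show (⨆ x, op (φ x) ((sSup S) x)) = ⨆ lam ∈ S, ⨆ x, op (φ x) (lam x)
      apply eq_of_forall_ge_iff
      intro c
      simp only [iSup_le_iff, sSup_apply, adj, Subtype.forall]
      exact ⟨fun h l hl x => h x l hl, fun h x l hl => h l hl x⟩)
    (by
      intro lam _ r
      show (⨆ x, op (φ x) (op (lam x) r)) = op (⨆ x, op (φ x) (lam x)) r
      rw [opS']
      simp only [assoc])
  refine ⟨a, ha, fun y => ?_⟩
  apply eq_of_forall_le_iff
  intro r
  have e : ∀ (lam : X → Q) (x : X), op (op (φ x) (lam x)) r = op (lam x) (op (φ x) r) := by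
    intro lam x
    rw [comm (φ x), assoc]
  calc r ≤ Ω a y ↔ ∀ lam ∈ τ, op (lam a) r ≤ lam y := by
        rw [hΩ]; simp only [le_iInf_iff, adj]
    _ ↔ ∀ lam ∈ τ, ∀ x, op (lam x) (op (φ x) r) ≤ lam y := by
        refine forall₂_congr fun lam hl => ?_
        rw [← ha lam hl]
        show op (⨆ x, op (φ x) (lam x)) r ≤ _ ↔ _
        rw [opS', iSup_le_iff]
        simp only [e]
    _ ↔ r ≤ ⨅ x, imp (φ x) (Ω x y) := by
        simp only [le_iInf_iff, ← adj, hΩ]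
        exact ⟨fun h x l hl => h l hl x, fun h l hl x => h x l hl⟩
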